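/- Composition of a gauge symmetry with a linear differential operator on parameters is a gauge symmetry: let L ∈ R, let the finitely supported family υ = (υ^{i,Ξ}_r)_{i∈ι,r∈ρ,Ξ∈M} be a gauge symmetry of L with parameter indices ρ, let ρ' be another type, and let h = (h^{r,Ξ'}_s)_{r∈ρ, s∈ρ', Ξ'∈M} be a finitely supported family of elements of R. Define the composed family υ'^{i,Θ}_s := Σ_{r∈ρ} Σ_{Ξ,Ξ',Σ : Σ ≤ Ξ, (Ξ−Σ)+Ξ' = Θ} C(Ξ,Σ) · υ^{i,Ξ}_r · d_Σ(h^{r,Ξ'}_s), where C(Ξ,Σ) := ∏_λ Nat.choose (Ξ(λ)) (Σ(λ)). Then υ' is a gauge symmetry of L with parameter indices ρ', i.e. Σ_{i,s,Θ} ι̂'(υ'^{i,Θ}_s) · ξ'^s_Θ · ι̂'(E_i(L)) is a total divergence in R'' := MvPolynomial ((ι ⊕ ρ') × M) k. -/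

import Mathlib

/-- Size `|Λ|` of a multi-index. -/
def msize {n : ℕ} (Λ : Fin n →₀ ℕ) : ℕ := ∑ i, Λ i

/-- Multi-index binomial coefficient `C(Λ, T) = ∏ λ, choose (Λ λ) (T λ)`. -/
def mchoose {n : ℕ} (Λ T : Fin n →₀ ℕ) : ℕ := ∏ i, (Λ i).choose (T i)

/-- Iterated derivative `d_Λ = ∏ λ (d λ)^[Λ λ]` (well defined for commuting `d λ`). -/
def dIter {R : Type*} {n : ℕ} (d : Fin n → R → R) (Λ : Fin n →₀ ℕ) : R → R :=
  (List.finRange n).foldr (fun i acc => (d i)^[Λ i] ∘ acc) id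

/-- The total derivative `d_λ` on `MvPolynomial (τ × M) k`, the unique `k`-derivation
with `d_λ (X (j, Λ)) = X (j, Λ + e_λ)`. -/
noncomputable def totalDeriv (k : Type*) [CommRing k] {n : ℕ} (τ : Type*) (l : Fin n) :
    Derivation k (MvPolynomial (τ × (Fin n →₀ ℕ)) k) (MvPolynomial (τ × (Fin n →₀ ℕ)) k) :=
  MvPolynomial.mkDerivation k fun p => MvPolynomial.X (p.1, p.2 + Finsupp.single l 1)

/-- The Euler–Lagrange derivative `E_i (L) = ∑_Λ (-1)^{|Λ|} d_Λ (∂_{(i,Λ)} L)`. -/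
noncomputable def EL (k : Type*) [CommRing k] {n : ℕ} (ι : Type*) (i : ι)
    (L : MvPolynomial (ι × (Fin n →₀ ℕ)) k) : MvPolynomial (ι × (Fin n →₀ ℕ)) k :=
  ∑ᶠ Λ : Fin n →₀ ℕ, (-1 : MvPolynomial (ι × (Fin n →₀ ℕ)) k) ^ msize Λ *
    dIter (fun l => ⇑(totalDeriv k ι l)) Λ (MvPolynomial.pderiv (i, Λ) L)

/-- The `k`-algebra embedding induced by `(i, Λ) ↦ (Sum.inl i, Λ)`. -/
noncomputable def fieldEmb (k : Type*) [CommRing k] {n : ℕ} (ι τ : Type*) :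
    MvPolynomial (ι × (Fin n →₀ ℕ)) k →ₐ[k] MvPolynomial ((ι ⊕ τ) × (Fin n →₀ ℕ)) k :=
  MvPolynomial.rename fun p => (Sum.inl p.1, p.2)

/-- An element of `MvPolynomial (τ × M) k` is a total divergence if it equals
`∑_λ d_λ (σ^λ)` for some `σ^λ`. -/
def IsTotalDiv (k : Type*) [CommRing k] {n : ℕ} {τ : Type*}
    (f : MvPolynomial (τ × (Fin n →₀ ℕ)) k) : Prop :=
  ∃ σ : Fin n → MvPolynomial (τ × (Fin n →₀ ℕ)) k, f = ∑ l, totalDeriv k τ l (σ l)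

/-- A finitely supported family `υ = (υ^{i,Ξ}_r)` is a gauge symmetry of `L` with
parameter indices `τ` if `∑_{i,r,Ξ} ι̂(υ^{i,Ξ}_r) ξ^r_Ξ ι̂(E_i(L))` is a total
divergence. -/
def IsGaugeSymmetry (k : Type*) [CommRing k] {n : ℕ} (ι τ : Type*)
    (υ : ι → τ → (Fin n →₀ ℕ) → MvPolynomial (ι × (Fin n →₀ ℕ)) k)
    (L : MvPolynomial (ι × (Fin n →₀ ℕ)) k) : Prop :=
  IsTotalDiv k (∑ᶠ p : ι × τ × (Fin n →₀ ℕ),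
    fieldEmb k ι τ (υ p.1 p.2.1 p.2.2) * MvPolynomial.X ((Sum.inr p.2.1 : ι ⊕ τ), p.2.2) *
      fieldEmb k ι τ (EL k ι p.1 L))


theorem foldr_not_mem {R : Type*} {n : ℕ} (d : Fin n → R → R) (Λ : Fin n →₀ ℕ) (l : Fin n)
    (L : List (Fin n)) (hl : l ∉ L) :
    L.foldr (fun i acc => (d i)^[(Λ + Finsupp.single l 1 : Fin n →₀ ℕ) i] ∘ acc) id =
      L.foldr (fun i acc => (d i)^[Λ i] ∘ acc) id := by
  induction L with
  | nil => rfl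
  | cons a L ih =>
    simp only [List.mem_cons, not_or] at hl
    simp only [List.foldr_cons]
    rw [ih hl.2]
    simp [Finsupp.single_apply, hl.1]

theorem foldr_mem {R : Type*} {n : ℕ} (d : Fin n → R → R)
    (hd : ∀ i j, Function.Commute (d i) (d j)) (Λ : Fin n →₀ ℕ) (l : Fin n)
    (L : List (Fin n)) (hL : L.Nodup) (hl : l ∈ L) :
    L.foldr (fun i acc => (d i)^[(Λ + Finsupp.single l 1 : Fin n →₀ ℕ) i] ∘ acc) id =
      d l ∘ L.foldr (fun i acc => (d i)^[Λ i] ∘ acc) id := by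
  induction L with
  | nil => simp at hl
  | cons a L ih =>
    rw [List.nodup_cons] at hL
    simp only [List.foldr_cons]
    by_cases hal : l = a
    · subst hal
      rw [foldr_not_mem d Λ l L hL.1]
      have : (Λ + Finsupp.single l 1 : Fin n →₀ ℕ) l = Λ l + 1 := by simp
      rw [this, Function.iterate_succ', Function.comp_assoc]
    · have hl' : l ∈ L := by simpa [hal] using hl
      rw [ih hL.2 hl']
      have : (Λ + Finsupp.single l 1 : Fin n →₀ ℕ) a = Λ a := by simp [Finsupp.single_apply, hal]
      rw [this, ← Function.comp_assoc, ← Function.comp_assoc]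
      congr 1
      funext x
      exact ((hd a l).iterate_left (Λ a)) x

theorem dIter_add_single {R : Type*} {n : ℕ} (d : Fin n → R → R)
    (hd : ∀ i j, Function.Commute (d i) (d j)) (Λ : Fin n →₀ ℕ) (l : Fin n) (x : R) :
    dIter d (Λ + Finsupp.single l 1 : Fin n →₀ ℕ) x = d l (dIter d Λ x) := by
  have := foldr_mem d hd Λ l (List.finRange n) (List.nodup_finRange n) (List.mem_finRange l)
  exact congrFun this x

theorem dIter_zero {R : Type*} {n : ℕ} (d : Fin n → R → R) (x : R) :
    dIter d 0 x = x := by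
  unfold dIter
  induction List.finRange n with
  | nil => rfl
  | cons a L ih => simpa using ih

theorem mindex_induction {n : ℕ} {P : (Fin n →₀ ℕ) → Prop} (h0 : P 0)
    (hs : ∀ Λ l, P Λ → P (Λ + Finsupp.single l 1)) (Λ : Fin n →₀ ℕ) : P Λ := by
  have key : ∀ (m : ℕ) (Λ : Fin n →₀ ℕ), ∑ i, Λ i = m → P Λ := by
    intro m
    induction m with
    | zero =>
      intro Λ h
      have : Λ = 0 := by
        ext i
        simpa using (Finset.sum_eq_zero_iff.1 h) i (Finset.mem_univ i)
      rwa [this]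
    | succ m ih =>
      intro Λ h
      obtain ⟨l, _, hl⟩ := Finset.exists_ne_zero_of_sum_ne_zero (by omega : ∑ i, Λ i ≠ 0)
      have hle : Finsupp.single l 1 ≤ Λ := by
        rw [Finsupp.single_le_iff]; omega
      have he := tsub_add_cancel_of_le hle
      rw [← he]
      apply hs
      apply ih
      have h2 : ∑ i, (Λ - Finsupp.single l 1 + Finsupp.single l 1 : Fin n →₀ ℕ) i = m + 1 := by rw [he, h]
      simp only [Finsupp.add_apply, Finset.sum_add_distrib] at h2
      have h3 : ∑ i, (Finsupp.single l 1 : Fin n →₀ ℕ) i = 1 := by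
        simp [Finsupp.single_apply]
      omega
  exact key _ Λ rfl

section
variable {k : Type*} [CommRing k] {n : ℕ} {τ τ' : Type*}

theorem totalDeriv_X (l : Fin n) (p : τ × (Fin n →₀ ℕ)) :
    totalDeriv k τ l (MvPolynomial.X p) = MvPolynomial.X (p.1, p.2 + Finsupp.single l 1) := by
  simp [totalDeriv, MvPolynomial.mkDerivation_X]

theorem totalDeriv_comm (i j : Fin n) :
    Function.Commute (totalDeriv k τ i) (totalDeriv k τ j) := by
  intro f
  induction f using MvPolynomial.induction_on with
  | C a => simp [MvPolynomial.derivation_C]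
  | add p q hp hq => simp only [map_add, hp, hq]
  | mul_X p x hp =>
    simp only [Derivation.leibniz, totalDeriv_X, map_add, smul_eq_mul, hp]
    rw [add_right_comm x.2]
    ring

theorem hom_comm (φ : MvPolynomial (τ × (Fin n →₀ ℕ)) k →ₐ[k] MvPolynomial (τ' × (Fin n →₀ ℕ)) k)
    (l : Fin n)
    (hφ : ∀ p, φ (totalDeriv k τ l (MvPolynomial.X p)) = totalDeriv k τ' l (φ (MvPolynomial.X p)))
    (f : MvPolynomial (τ × (Fin n →₀ ℕ)) k) :
    φ (totalDeriv k τ l f) = totalDeriv k τ' l (φ f) := by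
  induction f using MvPolynomial.induction_on with
  | C a =>
    rw [← MvPolynomial.algebraMap_eq, AlgHom.commutes]
    simp
  | add p q hp hq => simp only [map_add, hp, hq]
  | mul_X p x hp =>
    simp only [Derivation.leibniz, map_add, smul_eq_mul, map_mul, hp, hφ]

/-- Abbreviation for the iterated total derivative. -/
noncomputable abbrev dT (k : Type*) [CommRing k] {n : ℕ} (τ : Type*) (Λ : Fin n →₀ ℕ) :
    MvPolynomial (τ × (Fin n →₀ ℕ)) k → MvPolynomial (τ × (Fin n →₀ ℕ)) k :=
  dIter (fun l => ⇑(totalDeriv k τ l)) Λ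

theorem dT_step (Λ : Fin n →₀ ℕ) (l : Fin n) (f : MvPolynomial (τ × (Fin n →₀ ℕ)) k) :
    dT k τ (Λ + Finsupp.single l 1 : Fin n →₀ ℕ) f = totalDeriv k τ l (dT k τ Λ f) :=
  dIter_add_single _ totalDeriv_comm Λ l f

theorem dT_sum {α : Type*} (s : Finset α) (F : α → MvPolynomial (τ × (Fin n →₀ ℕ)) k)
    (Λ : Fin n →₀ ℕ) : dT k τ Λ (∑ a ∈ s, F a) = ∑ a ∈ s, dT k τ Λ (F a) := by
  induction Λ using mindex_induction with
  | h0 => simp [dT, dIter_zero]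
  | hs Λ l ih => simp only [dT_step, ih, map_sum]

theorem dT_zero (Λ : Fin n →₀ ℕ) : dT k τ Λ 0 = 0 := by
  simpa using dT_sum (∅ : Finset ℕ) (fun _ => (0 : MvPolynomial (τ × (Fin n →₀ ℕ)) k)) Λ

theorem dT_X (Λ : Fin n →₀ ℕ) (j : τ) (Ξ : Fin n →₀ ℕ) :
    dT k τ Λ (MvPolynomial.X (j, Ξ)) = MvPolynomial.X (j, Λ + Ξ) := by
  induction Λ using mindex_induction with
  | h0 => simp [dT, dIter_zero]
  | hs Λ l ih =>
    simp only [dT_step, ih, totalDeriv_X]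
    rw [add_right_comm]

theorem dT_hom (φ : MvPolynomial (τ × (Fin n →₀ ℕ)) k →ₐ[k] MvPolynomial (τ' × (Fin n →₀ ℕ)) k)
    (hφ : ∀ l f, φ (totalDeriv k τ l f) = totalDeriv k τ' l (φ f))
    (Λ : Fin n →₀ ℕ) (f : MvPolynomial (τ × (Fin n →₀ ℕ)) k) :
    φ (dT k τ Λ f) = dT k τ' Λ (φ f) := by
  induction Λ using mindex_induction with
  | h0 => simp [dT, dIter_zero]
  | hs Λ l ih => simp only [dT_step, ih, hφ]

theorem mchoose_eq_zero (Λ S : Fin n →₀ ℕ) (h : ¬ S ≤ Λ) : mchoose Λ S = 0 := by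
  rw [Finsupp.le_def] at h
  push Not at h
  obtain ⟨i, hi⟩ := h
  exact Finset.prod_eq_zero (Finset.mem_univ i) (Nat.choose_eq_zero_of_lt hi)

theorem mchoose_add_single (Λ S : Fin n →₀ ℕ) (l : Fin n) :
    mchoose (Λ + Finsupp.single l 1) S =
      mchoose Λ S + if 0 < S l then mchoose Λ (S - Finsupp.single l 1) else 0 := by
  unfold mchoose
  rw [← Finset.mul_prod_erase _ _ (Finset.mem_univ l),
    ← Finset.mul_prod_erase _ (fun i => (Λ i).choose (S i)) (Finset.mem_univ l),
    ← Finset.mul_prod_erase _ (fun i => (Λ i).choose ((S - Finsupp.single l 1 : Fin n →₀ ℕ) i))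
      (Finset.mem_univ l)]
  have h1 : ∏ x ∈ Finset.univ.erase l, ((Λ + Finsupp.single l 1 : Fin n →₀ ℕ) x).choose (S x) =
      ∏ x ∈ Finset.univ.erase l, (Λ x).choose (S x) := by
    refine Finset.prod_congr rfl fun x hx => ?_
    have : l ≠ x := (Finset.ne_of_mem_erase hx).symm
    simp [Finsupp.single_apply, this]
  have h2 : ∏ x ∈ Finset.univ.erase l, (Λ x).choose ((S - Finsupp.single l 1 : Fin n →₀ ℕ) x) =
      ∏ x ∈ Finset.univ.erase l, (Λ x).choose (S x) := by
    refine Finset.prod_congr rfl fun x hx => ?_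
    have : l ≠ x := (Finset.ne_of_mem_erase hx).symm
    simp [Finsupp.single_apply, this]
  rw [h1, h2]
  rcases hS : S l with _ | m
  · simp
  · simp [hS, Nat.choose_succ_succ]
    ring

theorem pascal_sum {A : Type*} [CommRing A] (F : (Fin n →₀ ℕ) → (Fin n →₀ ℕ) → A)
    (Λ : Fin n →₀ ℕ) (l : Fin n) :
    ∑ S ∈ Finset.Iic (Λ + Finsupp.single l 1), (mchoose (Λ + Finsupp.single l 1) S : A) *
        F S (Λ + Finsupp.single l 1 - S) =
      ∑ S ∈ Finset.Iic Λ, (mchoose Λ S : A) *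
        (F S (Λ - S + Finsupp.single l 1) + F (S + Finsupp.single l 1) (Λ - S)) := by
  simp only [mchoose_add_single, Nat.cast_add, add_mul, mul_add, Finset.sum_add_distrib]
  congr 1
  · symm
    have hsub : Finset.Iic Λ ⊆ Finset.Iic (Λ + Finsupp.single l 1 : Fin n →₀ ℕ) :=
      Finset.Iic_subset_Iic.2 le_self_add
    rw [← Finset.sum_subset hsub]
    · refine Finset.sum_congr rfl fun S hS => ?_
      rw [tsub_add_eq_add_tsub (Finset.mem_Iic.1 hS)]
    · intro S _ hS
      rw [mchoose_eq_zero _ _ (by simpa using hS)]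
      simp
  · simp only [Nat.cast_ite, Nat.cast_zero, ite_mul, zero_mul]
    rw [← Finset.sum_filter]
    symm
    refine Finset.sum_bij (fun S _ => S + Finsupp.single l 1) ?_ ?_ ?_ ?_
    · intro S hS
      simp at hS ⊢
      exact hS
    · intro a _ b _ hab
      exact add_right_cancel hab
    · intro S hS
      simp only [Finset.mem_filter, Finset.mem_Iic] at hS
      have hle : Finsupp.single l 1 ≤ S := by
        rw [Finsupp.single_le_iff]; exact hS.2
      refine ⟨S - Finsupp.single l 1, ?_, tsub_add_cancel_of_le hle⟩
      rw [Finset.mem_Iic]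
      exact tsub_le_iff_right.2 hS.1
    · intro S hS
      rw [add_tsub_cancel_right, add_tsub_add_eq_tsub_right]

theorem dT_mul (Λ : Fin n →₀ ℕ) (f g : MvPolynomial (τ × (Fin n →₀ ℕ)) k) :
    dT k τ Λ (f * g) = ∑ S ∈ Finset.Iic Λ,
      (mchoose Λ S : MvPolynomial (τ × (Fin n →₀ ℕ)) k) * (dT k τ S f * dT k τ (Λ - S) g) := by
  induction Λ using mindex_induction with
  | h0 =>
    have : Finset.Iic (0 : Fin n →₀ ℕ) = {0} := by ext; simp
    simp [this, dT, dIter_zero, mchoose]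
  | hs Λ l ih =>
    rw [pascal_sum (fun S T => dT k τ S f * dT k τ T g), dT_step, ih, map_sum]
    refine Finset.sum_congr rfl fun S _ => ?_
    simp only [dT_step, Derivation.leibniz, Derivation.map_natCast, smul_eq_mul]
    ring

theorem fieldEmb_totalDeriv {ι : Type*} (l : Fin n) (f : MvPolynomial (ι × (Fin n →₀ ℕ)) k) :
    fieldEmb k ι τ (totalDeriv k ι l f) = totalDeriv k (ι ⊕ τ) l (fieldEmb k ι τ f) := by
  refine hom_comm _ l (fun p => ?_) f
  simp [totalDeriv_X, fieldEmb]

end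

open Classical in
/-- Composition of a gauge symmetry with a linear differential operator on the
parameters is a gauge symmetry:
`υ'^{i,Θ}_s = ∑_{r} ∑_{Ξ,Ξ',S : S ≤ Ξ, (Ξ-S)+Ξ' = Θ} C(Ξ,S) υ^{i,Ξ}_r d_S (h^{r,Ξ'}_s)`
is a gauge symmetry with parameter indices `ρ'`. -/
theorem gauge_symmetry_comp (k : Type*) [CommRing k] (n : ℕ) (hn : 1 ≤ n)
    (ι ρ ρ' : Type*) (L : MvPolynomial (ι × (Fin n →₀ ℕ)) k)
    (υ : ι → ρ → (Fin n →₀ ℕ) → MvPolynomial (ι × (Fin n →₀ ℕ)) k)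
    (hυ : (Function.support fun p : ι × ρ × (Fin n →₀ ℕ) => υ p.1 p.2.1 p.2.2).Finite)
    (hsym : IsGaugeSymmetry k ι ρ υ L)
    (h : ρ → ρ' → (Fin n →₀ ℕ) → MvPolynomial (ι × (Fin n →₀ ℕ)) k)
    (hh : (Function.support fun p : ρ × ρ' × (Fin n →₀ ℕ) => h p.1 p.2.1 p.2.2).Finite) :
    IsGaugeSymmetry k ι ρ'
      (fun i s Θ => ∑ᶠ r : ρ, ∑ᶠ t : (Fin n →₀ ℕ) × (Fin n →₀ ℕ) × (Fin n →₀ ℕ),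
        if t.2.2 ≤ t.1 ∧ (t.1 - t.2.2) + t.2.1 = Θ then
          (mchoose t.1 t.2.2 : MvPolynomial (ι × (Fin n →₀ ℕ)) k) * υ i r t.1 *
            dIter (fun l => ⇑(totalDeriv k ι l)) t.2.2 (h r s t.2.1)
        else 0) L := by
  classical
  obtain ⟨σ, hσ⟩ := hsym
  set A := hυ.toFinset.image (fun p => p.1) with hA
  set B := hυ.toFinset.image (fun p => p.2.1) with hB
  set C := hυ.toFinset.image (fun p => p.2.2) with hC
  set S := hh.toFinset.image (fun p => p.2.1) with hS
  set D := hh.toFinset.image (fun p => p.2.2) with hD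
  have hυA : ∀ i r Ξ, υ i r Ξ ≠ 0 → i ∈ A ∧ r ∈ B ∧ Ξ ∈ C := by
    intro i r Ξ hne
    have hm : (i, r, Ξ) ∈ hυ.toFinset := by simpa using hne
    exact ⟨Finset.mem_image_of_mem (fun p : ι × ρ × (Fin n →₀ ℕ) => p.1) hm,
      Finset.mem_image_of_mem (fun p : ι × ρ × (Fin n →₀ ℕ) => p.2.1) hm,
      Finset.mem_image_of_mem (fun p : ι × ρ × (Fin n →₀ ℕ) => p.2.2) hm⟩
  have hhS : ∀ r s Ξ, h r s Ξ ≠ 0 → s ∈ S ∧ Ξ ∈ D := by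
    intro r s Ξ hne
    have hm : (r, s, Ξ) ∈ hh.toFinset := by simpa using hne
    exact ⟨Finset.mem_image_of_mem (fun p : ρ × ρ' × (Fin n →₀ ℕ) => p.2.1) hm,
      Finset.mem_image_of_mem (fun p : ρ × ρ' × (Fin n →₀ ℕ) => p.2.2) hm⟩
  set T := C.biUnion (fun Ξ => Finset.Iic Ξ) with hT
  set Q := C ×ˢ D ×ˢ T with hQ
  set Th := Q.image (fun t => (t.1 - t.2.2) + t.2.1) with hTh
  set tm : ι → ρ → ρ' → (Fin n →₀ ℕ) × (Fin n →₀ ℕ) × (Fin n →₀ ℕ) →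
      MvPolynomial (ι × (Fin n →₀ ℕ)) k := fun i r s t =>
    (mchoose t.1 t.2.2 : MvPolynomial (ι × (Fin n →₀ ℕ)) k) * υ i r t.1 *
            dIter (fun l => ⇑(totalDeriv k ι l)) t.2.2 (h r s t.2.1) with htm
  have htm0 : ∀ i r s t, tm i r s t ≠ 0 → i ∈ A ∧ r ∈ B ∧ s ∈ S ∧ t ∈ Q := by
    intro i r s t hne
    have h1 : υ i r t.1 ≠ 0 := fun h0 => hne (by simp [htm, h0])
    have h2 : h r s t.2.1 ≠ 0 := fun h0 => hne (by
      have := dT_zero (k := k) (τ := ι) t.2.2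
      simp only [dT] at this
      simp [htm, h0, this])
    have h3 : t.2.2 ≤ t.1 := by
      by_contra h0
      exact hne (by simp [htm, mchoose_eq_zero _ _ h0])
    obtain ⟨a, b, c⟩ := hυA _ _ _ h1
    obtain ⟨d, e⟩ := hhS _ _ _ h2
    refine ⟨a, b, d, ?_⟩
    simp only [hQ, Finset.mem_product]
    exact ⟨c, e, Finset.mem_biUnion.2 ⟨t.1, c, Finset.mem_Iic.2 h3⟩⟩
  -- the composed family as a finite sum
  have hυ' : ∀ i s Θ, (∑ᶠ r : ρ, ∑ᶠ t : (Fin n →₀ ℕ) × (Fin n →₀ ℕ) × (Fin n →₀ ℕ),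
        if t.2.2 ≤ t.1 ∧ (t.1 - t.2.2) + t.2.1 = Θ then tm i r s t else 0) =
      ∑ r ∈ B, ∑ t ∈ Q, if (t.1 - t.2.2) + t.2.1 = Θ then tm i r s t else 0 := by
    intro i s Θ
    have hin : ∀ r, (∑ᶠ t : (Fin n →₀ ℕ) × (Fin n →₀ ℕ) × (Fin n →₀ ℕ),
        if t.2.2 ≤ t.1 ∧ (t.1 - t.2.2) + t.2.1 = Θ then tm i r s t else 0) =
        ∑ t ∈ Q, if (t.1 - t.2.2) + t.2.1 = Θ then tm i r s t else 0 := by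
      intro r
      have : ∀ t : (Fin n →₀ ℕ) × (Fin n →₀ ℕ) × (Fin n →₀ ℕ),
          (if t.2.2 ≤ t.1 ∧ (t.1 - t.2.2) + t.2.1 = Θ then tm i r s t else 0) =
          if (t.1 - t.2.2) + t.2.1 = Θ then tm i r s t else 0 := by
        intro t
        by_cases h0 : t.2.2 ≤ t.1
        · simp [h0]
        · have : tm i r s t = 0 := by simp [htm, mchoose_eq_zero _ _ h0]
          simp [this]
      simp only [this]
      refine finsum_eq_sum_of_support_subset _ ?_
      intro t ht
      rw [Function.mem_support] at ht
      have : tm i r s t ≠ 0 := fun h0 => ht (by simp [h0])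
      exact (htm0 _ _ _ _ this).2.2.2
    simp only [hin]
    refine finsum_eq_sum_of_support_subset _ ?_
    intro r hr
    rw [Function.mem_support] at hr
    obtain ⟨t, _, ht⟩ := Finset.exists_ne_zero_of_sum_ne_zero hr
    have : tm i r s t ≠ 0 := fun h0 => ht (by simp [h0])
    exact (htm0 _ _ _ _ this).2.1
  -- the substitution homomorphism
  set H : ρ → MvPolynomial ((ι ⊕ ρ') × (Fin n →₀ ℕ)) k := fun r => ∑ s ∈ S, ∑ Ξ ∈ D,
    fieldEmb k ι ρ' (h r s Ξ) * MvPolynomial.X ((Sum.inr s : ι ⊕ ρ'), Ξ) with hH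
  set φ : MvPolynomial ((ι ⊕ ρ) × (Fin n →₀ ℕ)) k →ₐ[k]
      MvPolynomial ((ι ⊕ ρ') × (Fin n →₀ ℕ)) k := MvPolynomial.aeval (fun p =>
    Sum.elim (fun i => MvPolynomial.X ((Sum.inl i : ι ⊕ ρ'), p.2))
      (fun r => dT k (ι ⊕ ρ') p.2 (H r)) p.1) with hφ
  have hφd : ∀ l f, φ (totalDeriv k _ l f) = totalDeriv k _ l (φ f) := by
    intro l f
    refine hom_comm φ l ?_ f
    rintro ⟨i | r, Λ⟩
    · simp [totalDeriv_X, hφ]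
    · simp only [totalDeriv_X, hφ, MvPolynomial.aeval_X, Sum.elim_inr]
      exact dT_step _ _ _
  have hφe : ∀ f, φ (fieldEmb k ι ρ f) = fieldEmb k ι ρ' f := by
    intro f
    simp only [fieldEmb, hφ, MvPolynomial.aeval_rename]
    rw [MvPolynomial.rename_eq_aeval]
    rfl
  refine ⟨fun l => φ (σ l), ?_⟩
  have key := congrArg φ hσ
  rw [map_sum] at key
  simp only [hφd] at key
  rw [← key]
  rw [finsum_eq_sum_of_support_subset (s := A ×ˢ B ×ˢ C)]
  swap
  · intro p hp
    rw [Function.mem_support] at hp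
    have : υ p.1 p.2.1 p.2.2 ≠ 0 := fun h0 => hp (by simp [h0])
    obtain ⟨a, b, c⟩ := hυA _ _ _ this
    simp [a, b, c]
  refine (finsum_congr (g := fun p : ι × ρ' × (Fin n →₀ ℕ) => fieldEmb k ι ρ'
      (∑ r ∈ B, ∑ t ∈ Q, if (t.1 - t.2.2) + t.2.1 = p.2.2 then tm p.1 r p.2.1 t else 0) *
        MvPolynomial.X ((Sum.inr p.2.1 : ι ⊕ ρ'), p.2.2) * fieldEmb k ι ρ' (EL k ι p.1 L))
      fun p => ?_).trans ?_
  · exact congrArg (fun z => fieldEmb k ι ρ' z *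
        MvPolynomial.X ((Sum.inr p.2.1 : ι ⊕ ρ'), p.2.2) * fieldEmb k ι ρ' (EL k ι p.1 L))
      (hυ' p.1 p.2.1 p.2.2)
  rw [finsum_eq_sum_of_support_subset (s := A ×ˢ S ×ˢ Th)]
  swap
  · intro p hp
    rw [Function.mem_support] at hp
    have h1 : (∑ r ∈ B, ∑ t ∈ Q, if (t.1 - t.2.2) + t.2.1 = p.2.2 then tm p.1 r p.2.1 t else 0)
        ≠ 0 := fun h0 => hp (by rw [h0]; simp)
    obtain ⟨r, _, hr⟩ := Finset.exists_ne_zero_of_sum_ne_zero h1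
    obtain ⟨t, ht, hr⟩ := Finset.exists_ne_zero_of_sum_ne_zero hr
    have h2 : (t.1 - t.2.2) + t.2.1 = p.2.2 := by
      by_contra h0
      exact hr (by simp [h0])
    have h3 : tm p.1 r p.2.1 t ≠ 0 := fun h0 => hr (by simp [h0])
    obtain ⟨a, b, c, d⟩ := htm0 _ _ _ _ h3
    have e : p.2.2 ∈ Th := Finset.mem_image.2 ⟨t, ht, h2⟩
    simp [a, c, e]
  simp only [map_sum, map_mul, hφe, Finset.sum_product]
  refine Finset.sum_congr rfl fun i _ => ?_
  -- right-hand side, one term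
  have hR : ∀ r ∈ B, ∀ Ξ ∈ C, φ (MvPolynomial.X ((Sum.inr r : ι ⊕ ρ), Ξ)) =
      ∑ s ∈ S, ∑ Ξ' ∈ D, ∑ U ∈ T, (mchoose Ξ U : MvPolynomial ((ι ⊕ ρ') × (Fin n →₀ ℕ)) k) *
        (fieldEmb k ι ρ' (dT k ι U (h r s Ξ')) *
          MvPolynomial.X ((Sum.inr s : ι ⊕ ρ'), Ξ - U + Ξ')) := by
    intro r _ Ξ hΞ
    simp only [hφ, MvPolynomial.aeval_X, Sum.elim_inr, hH, dT_sum]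
    refine Finset.sum_congr rfl fun s _ => Finset.sum_congr rfl fun Ξ' _ => ?_
    rw [dT_mul]
    have hsub : Finset.Iic Ξ ⊆ T := fun U hU => Finset.mem_biUnion.2 ⟨Ξ, hΞ, hU⟩
    rw [← Finset.sum_subset hsub]
    · refine Finset.sum_congr rfl fun U _ => ?_
      rw [dT_X, dT_hom _ fieldEmb_totalDeriv]
    · intro U _ hU
      rw [mchoose_eq_zero _ _ (by simpa using hU)]
      simp
  have hRR : ∑ r ∈ B, ∑ Ξ ∈ C, fieldEmb k ι ρ' (υ i r Ξ) *
        φ (MvPolynomial.X ((Sum.inr r : ι ⊕ ρ), Ξ)) * fieldEmb k ι ρ' (EL k ι i L) =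
      ∑ r ∈ B, ∑ s ∈ S, ∑ t ∈ Q, fieldEmb k ι ρ' (tm i r s t) *
        MvPolynomial.X ((Sum.inr s : ι ⊕ ρ'), t.1 - t.2.2 + t.2.1) *
          fieldEmb k ι ρ' (EL k ι i L) := by
    refine Finset.sum_congr rfl fun r hr => ?_
    rw [Finset.sum_congr rfl fun Ξ hΞ => by rw [hR r hr Ξ hΞ]]
    simp only [Finset.mul_sum, Finset.sum_mul]
    rw [Finset.sum_comm]
    refine Finset.sum_congr rfl fun s _ => ?_
    simp only [hQ, Finset.sum_product]
    refine Finset.sum_congr rfl fun Ξ _ => Finset.sum_congr rfl fun Ξ' _ =>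
      Finset.sum_congr rfl fun U _ => ?_
    simp only [htm, map_mul, map_natCast]
    ring
  rw [hRR, Finset.sum_comm (s := B)]
  refine Finset.sum_congr rfl fun s _ => ?_
  simp only [Finset.sum_mul]
  rw [Finset.sum_comm]
  refine Finset.sum_congr rfl fun r _ => ?_
  rw [Finset.sum_comm]
  refine Finset.sum_congr rfl fun t ht => ?_
  rw [Finset.sum_eq_single ((t.1 - t.2.2) + t.2.1)]
  · simp
  · intro Θ _ hne
    simp [hne.symm]
  · intro h0
    exact absurd (Finset.mem_image_of_mem _ ht) h0
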